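/- Let P be a generic convex polygon with n ≥ 6 vertices and let P_1 and P_2 be the two polygons resulting from a decomposition of P (each having at least four vertices). Then l_-(P) ≥ l_-(P_1) + l_-(P_2) − 2. -/

import Mathlib

open EuclideanGeometry
open scoped Classical

noncomputable section

/-- The Euclidean plane. -/
abbrev Pt := EuclideanSpace ℝ (Fin 2)

/-- Signed area determinant of the triangle `a b c` (positive iff `a b c` is
counterclockwise, i.e. `c` lies strictly to the left of the directed line `a → b`). -/
def det2 (a b c : Pt) : ℝ :=
  (b 0 - a 0) * (c 1 - a 1) - (b 1 - a 1) * (c 0 - a 0)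

/-- The vertices `V 0, V 1, …, V (n-1)` (indices mod `n`) are distinct and in convex
position, listed counterclockwise: every other vertex lies strictly to the left of
each directed edge. -/
def ConvexCCW {n : ℕ} (V : ZMod n → Pt) : Prop :=
  Function.Injective V ∧
    ∀ i j : ZMod n, j ≠ i → j ≠ i + 1 → 0 < det2 (V i) (V (i + 1)) (V j)

/-- The polygon is generic: no three vertices are collinear and no four vertices lie
on a common circle. -/
def GenericPoly {n : ℕ} (V : ZMod n → Pt) : Prop :=
  (∀ i j k : ZMod n, i ≠ j → j ≠ k → i ≠ k →
      ¬ Collinear ℝ ({V i, V j, V k} : Set Pt)) ∧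
  (∀ i j k l : ZMod n, i ≠ j → i ≠ k → i ≠ l → j ≠ k → j ≠ l → k ≠ l →
      ¬ ∃ (O : Pt) (R : ℝ),
        dist (V i) O = R ∧ dist (V j) O = R ∧ dist (V k) O = R ∧ dist (V l) O = R)

/-- `O i` is the center and `R i` the radius of the circle `C i` through
`V (i-1)`, `V i`, `V (i+1)`. -/
def IsCircumData {n : ℕ} (V O : ZMod n → Pt) (R : ZMod n → ℝ) : Prop :=
  ∀ i : ZMod n,
    dist (V (i - 1)) (O i) = R i ∧ dist (V i) (O i) = R i ∧
      dist (V (i + 1)) (O i) = R i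

/-- The polygon is coherent: each circumcenter `O i` lies in the closed infinite cone
with apex `V i` spanned by the rays from `V i` through `V (i-1)` and `V (i+1)`. -/
def Coherent {n : ℕ} (V O : ZMod n → Pt) : Prop :=
  ∀ i : ZMod n, ∃ s t : ℝ, 0 ≤ s ∧ 0 ≤ t ∧
    O i - V i = s • (V (i - 1) - V i) + t • (V (i + 1) - V i)

/-- `V i` is locally maximal-extremal: `V (i-2)` and `V (i+2)` lie strictly outside `C i`. -/
def LocMax {n : ℕ} (V O : ZMod n → Pt) (R : ZMod n → ℝ) (i : ZMod n) : Prop :=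
  R i < dist (V (i - 2)) (O i) ∧ R i < dist (V (i + 2)) (O i)

/-- `V i` is locally minimal-extremal: `V (i-2)` and `V (i+2)` lie strictly inside `C i`. -/
def LocMin {n : ℕ} (V O : ZMod n → Pt) (R : ZMod n → ℝ) (i : ZMod n) : Prop :=
  dist (V (i - 2)) (O i) < R i ∧ dist (V (i + 2)) (O i) < R i

/-- `V i` is globally maximal-extremal: the open disk bounded by `C i` contains no vertex. -/
def GlobMax {n : ℕ} (V O : ZMod n → Pt) (R : ZMod n → ℝ) (i : ZMod n) : Prop :=
  ∀ j : ZMod n, R i ≤ dist (V j) (O i)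

/-- `V i` is globally minimal-extremal: the open disk bounded by `C i` contains every
vertex other than `V (i-1)`, `V i`, `V (i+1)`. -/
def GlobMin {n : ℕ} (V O : ZMod n → Pt) (R : ZMod n → ℝ) (i : ZMod n) : Prop :=
  ∀ j : ZMod n, j ≠ i - 1 → j ≠ i → j ≠ i + 1 → dist (V j) (O i) < R i

/-- `V i` is radially maximal-extremal: `R (i-1) < R i > R (i+1)`. -/
def RadMax {n : ℕ} (R : ZMod n → ℝ) (i : ZMod n) : Prop :=
  R (i - 1) < R i ∧ R (i + 1) < R i

/-- `V i` is radially minimal-extremal: `R (i-1) > R i < R (i+1)`. -/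
def RadMin {n : ℕ} (R : ZMod n → ℝ) (i : ZMod n) : Prop :=
  R i < R (i - 1) ∧ R i < R (i + 1)

end

noncomputable section

/-- The sub-polygon of `V` cut off by the diagonal from `V a` to `V (a + m)`: its
vertex sequence is `V a, V (a+1), …, V (a+m)` (so it has `m + 1` vertices and the
diagonal is one of its edges). -/
def subPolygon {n : ℕ} [NeZero n] (V : ZMod n → Pt) (a : ZMod n) (m : ℕ) :
    ZMod (m + 1) → Pt :=
  fun j => V (a + (j.val : ZMod n))

end

/-- In-circle determinant. -/
def inC (A B C D : Pt) : ℝ :=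
  ((D 0 - B 0) * (D 0 - C 0) + (D 1 - B 1) * (D 1 - C 1)) * det2 B C A -
  ((A 0 - B 0) * (A 0 - C 0) + (A 1 - B 1) * (A 1 - C 1)) * det2 B C D

/-- Dot product `(X - B) · (X - C)`. -/
def dt (B C X : Pt) : ℝ := (X 0 - B 0) * (X 0 - C 0) + (X 1 - B 1) * (X 1 - C 1)

/-- Sign of a quadruple. -/
noncomputable def q (A B C D : Pt) : Bool := decide (0 < inC A B C D)

/-- Indicator of an upward sign change. -/
def up (x y : Bool) : ℕ := if !x && y then 1 else 0

lemma q_iff (A B C D : Pt) : q A B C D = true ↔ 0 < inC A B C D := by simp [q]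

lemma det2_rot (a b c : Pt) : det2 b c a = det2 a b c := by
  unfold det2; ring

lemma det2_swap (a b c : Pt) : det2 b a c = - det2 a b c := by
  unfold det2; ring

lemma inC_rot (A B C D : Pt) : inC B C D A = - inC A B C D := by
  unfold inC det2; ring

lemma inC_pencil {A B C D : Pt} (hA : 0 < det2 B C A) (hD : 0 < det2 B C D) :
    0 < inC A B C D ↔ dt B C A / det2 B C A < dt B C D / det2 B C D := by
  rw [div_lt_div_iff₀ hA hD]
  unfold inC dt
  exact sub_pos

lemma rel1 {A B C D E : Pt} (hA : 0 < det2 B C A) (hD : 0 < det2 B C D) (hE : 0 < det2 B C E)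
    (h : q E B C D ≠ q A B C D) : q A B C D = q A B C E := by
  rw [ne_eq, Bool.eq_iff_iff, q_iff, q_iff, inC_pencil hE hD, inC_pencil hA hD] at h
  rw [Bool.eq_iff_iff, q_iff, q_iff, inC_pencil hA hD, inC_pencil hA hE]
  grind

lemma rel2 {A B C D E : Pt} (hA : 0 < det2 B C A) (hD : 0 < det2 B C D) (hE : 0 < det2 B C E)
    (h : q A B C E ≠ q A B C D) : q A B C D = !(q B C D E) := by
  have e : inC B C D E = inC D B C E := by unfold inC det2; ring
  have hs : q B C D E = q D B C E := by unfold q; rw [e]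
  rw [hs]
  rw [ne_eq, Bool.eq_iff_iff, q_iff, q_iff, inC_pencil hA hE, inC_pencil hA hD] at h
  rw [Bool.eq_iff_iff, Bool.not_eq_true', ← Bool.not_eq_true, q_iff, q_iff, inC_pencil hA hD,
    inC_pencil hD hE]
  grind

/-- Cyclic inequality in the pencil of circles through `B` and `C`. -/
lemma cyc {B C X Y U W : Pt} (hX : 0 < det2 B C X) (hY : 0 < det2 B C Y)
    (hU : 0 < det2 C B U) (hW : 0 < det2 C B W) :
    ¬ (q U C X B = true ∧ q Y B W C = false ∧ q Y B C X = true ∧ q U C B W = false) ∧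
    ¬ (q U C X B = false ∧ q Y B W C = true ∧ q Y B C X = false ∧ q U C B W = true) := by
  rw [det2_swap] at hU hW
  have key : ∀ Z, det2 B C Z ≠ 0 → ∃ c, dt B C Z = c * det2 B C Z := fun Z hZ =>
    ⟨dt B C Z / det2 B C Z, by field_simp⟩
  obtain ⟨x, hx⟩ := key X hX.ne'
  obtain ⟨y, hy⟩ := key Y hY.ne'
  obtain ⟨u, hu⟩ := key U (by linarith)
  obtain ⟨w, hw⟩ := key W (by linarith)
  have e1 : inC U C X B = (u - x) * (det2 B C X * - det2 B C U) := by
    have : inC U C X B = (dt B C X * det2 B C U - dt B C U * det2 B C X) := by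
      unfold inC dt det2; ring
    rw [this, hx, hu]; ring
  have e2 : inC Y B W C = (w - y) * (det2 B C Y * - det2 B C W) := by
    have : inC Y B W C = - (dt B C W * det2 B C Y - dt B C Y * det2 B C W) := by
      unfold inC dt det2; ring
    rw [this, hy, hw]; ring
  have e3 : inC Y B C X = (x - y) * (det2 B C X * det2 B C Y) := by
    have : inC Y B C X = (dt B C X * det2 B C Y - dt B C Y * det2 B C X) := by
      unfold inC dt det2; ring
    rw [this, hy, hx]; ring
  have e4 : inC U C B W = (u - w) * (- det2 B C U * - det2 B C W) := by
    have : inC U C B W = - (dt B C W * det2 B C U - dt B C U * det2 B C W) := by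
      unfold inC dt det2; ring
    rw [this, hu, hw]; ring
  simp only [← Bool.not_eq_true, q_iff, e1, e2, e3, e4]
  rw [mul_pos_iff_of_pos_right (by positivity), mul_pos_iff_of_pos_right (by positivity),
    mul_pos_iff_of_pos_right (by positivity), mul_pos_iff_of_pos_right (by positivity)]
  constructor <;> rintro ⟨h1, h2, h3, h4⟩ <;> linarith

lemma dist_sq (X O : Pt) : dist X O ^ 2 = (X 0 - O 0) ^ 2 + (X 1 - O 1) ^ 2 := by
  rw [EuclideanSpace.dist_eq, Real.sq_sqrt (by positivity)]
  simp [Fin.sum_univ_two, Real.dist_eq, sq_abs]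

lemma inC_circ {A B C D O : Pt} {R : ℝ} (hA : dist A O = R) (hB : dist B O = R)
    (hC : dist C O = R) : inC A B C D = (dist D O ^ 2 - R ^ 2) * det2 A B C := by
  have a := dist_sq A O
  have b := dist_sq B O
  have c := dist_sq C O
  rw [dist_sq]
  rw [hA] at a
  rw [hB] at b
  rw [hC] at c
  linear_combination (norm := skip) (det2 B C D) * a - (det2 C D A) * b + (det2 D A B) * c
  unfold inC det2
  ring

lemma inC_out {A B C D O : Pt} {R : ℝ} (hA : dist A O = R) (hB : dist B O = R)
    (hC : dist C O = R) (h : 0 < det2 A B C) : 0 < inC A B C D ↔ R < dist D O := by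
  rw [inC_circ hA hB hC, mul_pos_iff_of_pos_right h, sub_pos]
  have : 0 ≤ R := hA ▸ dist_nonneg
  exact sq_lt_sq₀ this dist_nonneg

lemma count_seq (M : ℕ) (T : ZMod (M + 1) → Bool) (b : ZMod (M + 1)) :
    {k : ZMod (M + 1) | T (k - 1 - 1) = false ∧ T (k - 1) = true}.ncard =
      up (T (b + (M : ℕ))) (T (b + (0 : ℕ))) +
        ∑ i ∈ Finset.range M, up (T (b + (i : ℕ))) (T (b + ((i + 1 : ℕ)))) := by
  have h1 : {k : ZMod (M + 1) | T (k - 1 - 1) = false ∧ T (k - 1) = true}.ncard =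
      ∑ k : ZMod (M + 1), up (T (k - 1 - 1)) (T (k - 1)) := by
    rw [Set.ncard_eq_toFinset_card', Set.toFinset_ofPred, Finset.card_filter]
    refine Finset.sum_congr rfl fun k _ => ?_
    simp [up]
  have h2 : ∑ k : ZMod (M + 1), up (T (k - 1 - 1)) (T (k - 1)) =
      ∑ k : ZMod (M + 1), up (T (b + k - 1)) (T (b + k)) := by
    symm
    refine Fintype.sum_equiv (Equiv.addRight (b + 1)) _ _ fun k => ?_
    simp only [Equiv.coe_addRight]
    have : k + (b + 1) - 1 = b + k := by ring
    rw [this]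
  have h3 : ∑ k : ZMod (M + 1), up (T (b + k - 1)) (T (b + k)) =
      ∑ i ∈ Finset.range (M + 1), up (T (b + (i : ℕ) - 1)) (T (b + (i : ℕ))) := by
    rw [Finset.sum_range]
    refine Fintype.sum_equiv (Equiv.refl (Fin (M + 1))) _ _ fun k => ?_
    have : (((Equiv.refl (Fin (M + 1))) k : ℕ) : ZMod (M + 1)) = k :=
      ZMod.natCast_zmod_val (n := M + 1) k
    rw [this]
  rw [h1, h2, h3, Finset.sum_range_succ', add_comm]
  congr 1
  · have : b + ((0 : ℕ) : ZMod (M + 1)) - 1 = b + (M : ℕ) := by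
      have h := ZMod.natCast_self (M + 1)
      push_cast at h ⊢
      linear_combination -h
    rw [this]
  · refine Finset.sum_congr rfl fun i _ => ?_
    have : b + ((i + 1 : ℕ) : ZMod (M + 1)) - 1 = b + (i : ℕ) := by
      push_cast; ring
    rw [this]

lemma natCast_ne {N : ℕ} {i j : ℕ} (h : i < j) (h' : j < i + N) : (i : ZMod N) ≠ (j : ZMod N) := by
  intro e
  rw [ZMod.natCast_eq_natCast_iff, Nat.modEq_iff_dvd' h.le] at e
  have := Nat.le_of_dvd (by omega) e
  omega

lemma count_poly (M : ℕ) (hM : 3 ≤ M) (W O : ZMod (M + 1) → Pt) (R : ZMod (M + 1) → ℝ)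
    (hc : IsCircumData W O R) (b : ZMod (M + 1)) (w : ℕ → Pt) (hw : ∀ i : ℕ, w i = W (b + i))
    (hdet : ∀ i, i ≤ M → 0 < det2 (w i) (w (i + 1)) (w (i + 2)))
    (hgen : ∀ i j k l : ZMod (M + 1), i ≠ j → i ≠ k → i ≠ l → j ≠ k → j ≠ l → k ≠ l →
      ¬ ∃ (O : Pt) (R : ℝ),
        dist (W i) O = R ∧ dist (W j) O = R ∧ dist (W k) O = R ∧ dist (W l) O = R) :
    {k | LocMax W O R k}.ncard =
      up (q (w M) (w (M + 1)) (w (M + 2)) (w (M + 3))) (q (w 0) (w 1) (w 2) (w 3)) +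
        ∑ i ∈ Finset.range M, up (q (w i) (w (i + 1)) (w (i + 2)) (w (i + 3)))
          (q (w (i + 1)) (w (i + 2)) (w (i + 3)) (w (i + 4))) := by
  have hdet' : ∀ k, 0 < det2 (W (k - 1)) (W k) (W (k + 1)) := by
    intro k
    have h := hdet (k - 1 - b).val (by have := ZMod.val_lt (k - 1 - b); omega)
    rw [hw, hw, hw] at h
    push_cast [ZMod.natCast_zmod_val] at h
    convert h using 3 <;> ring
  have h01 : ∀ i j : ℕ, i < j → j ≤ 3 → (i : ZMod (M + 1)) ≠ j := fun i j h h' =>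
    natCast_ne h (by omega)
  have hne : ∀ k, inC (W (k - 2)) (W (k - 1)) (W k) (W (k + 1)) ≠ 0 := by
    intro k h0
    obtain ⟨h1, h2, h3⟩ := hc k
    have e := inC_rot (W (k - 2)) (W (k - 1)) (W k) (W (k + 1))
    rw [h0, inC_circ h1 h2 h3] at e
    have e' : dist (W (k - 2)) (O k) ^ 2 - R k ^ 2 = 0 := by
      rcases mul_eq_zero.1 (e.trans neg_zero) with h | h
      · exact h
      · exact absurd h (hdet' k).ne'
    have e2 : dist (W (k - 2)) (O k) = R k := by
      have : 0 ≤ R k := h1 ▸ dist_nonneg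
      exact (sq_eq_sq₀ dist_nonneg this).1 (by linarith)
    have a01 := h01 0 1 (by norm_num) (by norm_num)
    have a02 := h01 0 2 (by norm_num) (by norm_num)
    have a03 := h01 0 3 (by norm_num) (by norm_num)
    push_cast at a01 a02 a03
    refine hgen (k - 2) (k - 1) k (k + 1) ?_ ?_ ?_ ?_ ?_ ?_ ⟨O k, R k, e2, h1, h2, h3⟩
    · intro h; apply a01; linear_combination h
    · intro h; apply a02; linear_combination h
    · intro h; apply a03; linear_combination h
    · intro h; apply a01; linear_combination h
    · intro h; apply a02; linear_combination h
    · intro h; apply a01; linear_combination h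
  let T : ZMod (M + 1) → Bool := fun k => q (W k) (W (k + 1)) (W (k + 2)) (W (k + 3))
  have hset : {k | LocMax W O R k} = {k | T (k - 1 - 1) = false ∧ T (k - 1) = true} := by
    ext k
    obtain ⟨h1, h2, h3⟩ := hc k
    simp only [Set.mem_ofPred_eq, LocMax, T]
    have e1 : k - 1 - 1 = k - 2 := by ring
    have e2 : k - 2 + 1 = k - 1 := by ring
    have e3 : k - 2 + 2 = k := by ring
    have e4 : k - 2 + 3 = k + 1 := by ring
    have e5 : k - 1 + 1 = k := by ring
    have e6 : k - 1 + 2 = k + 1 := by ring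
    have e7 : k - 1 + 3 = k + 2 := by ring
    rw [e1, e2, e3, e4, e5, e6, e7, ← Bool.not_eq_true, q_iff, q_iff,
      inC_out h1 h2 h3 (hdet' k), ← inC_out h1 h2 h3 (hdet' k), inC_rot]
    have := hne k
    have : 0 < - inC (W (k - 2)) (W (k - 1)) (W k) (W (k + 1)) ↔
      ¬ 0 < inC (W (k - 2)) (W (k - 1)) (W k) (W (k + 1)) := by
      rw [neg_pos, not_lt]
      exact ⟨le_of_lt, fun h => lt_of_le_of_ne h this⟩
    rw [this]
  have hT : ∀ i : ℕ, T (b + i) = q (w i) (w (i + 1)) (w (i + 2)) (w (i + 3)) := by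
    intro i
    simp only [T, hw]
    push_cast
    simp only [add_assoc]
  rw [hset, count_seq M T b]
  simp only [hT]

lemma boolF : ∀ s d1 d2 a0 b1 s0 sm x y : Bool, (x ≠ s0 → s0 = s) → (y ≠ sm → sm = !s) →
    up d1 x + up x a0 + up b1 y + up y d2 + (if !s && d1 && !d2 then 1 else 0) ≤
      up b1 sm + up sm s0 + up s0 a0 + 1 + (if !s && !d1 && d2 then 1 else 0) := by
  decide

lemma boolFin : ∀ s t d1 d2 : Bool,
    ¬ (s = true ∧ t = false ∧ d1 = true ∧ d2 = false) →
    ¬ (s = false ∧ t = true ∧ d1 = false ∧ d2 = true) →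
    ((if !s && !d1 && d2 then 1 else 0) + (if !t && !d2 && d1 then 1 else 0) : ℕ) ≤
     (if !s && d1 && !d2 then 1 else 0) + (if !t && d2 && !d1 then 1 else 0) := by
  decide

lemma count_sub {n : ℕ} [NeZero n] (V : ZMod n → Pt) (hgen : GenericPoly V) (a : ZMod n)
    (k : ℕ) (hkn : k + 6 ≤ n) (P : ℕ → Pt) (hP : ∀ i : ℕ, P i = V (a + i))
    (adj : ∀ i j, i + 2 ≤ j → j < i + n → 0 < det2 (P i) (P (i + 1)) (P j))
    (O : ZMod (k + 3 + 1) → Pt) (R : ZMod (k + 3 + 1) → ℝ)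
    (hc : IsCircumData (subPolygon V a (k + 3)) O R) :
    {j | LocMax (subPolygon V a (k + 3)) O R j}.ncard =
      up (q (P (k + 3)) (P 0) (P 1) (P 2)) (q (P 0) (P 1) (P 2) (P 3)) +
      (∑ i ∈ Finset.range k, up (q (P i) (P (i + 1)) (P (i + 2)) (P (i + 3)))
          (q (P (i + 1)) (P (i + 2)) (P (i + 3)) (P (i + 4))) +
       up (q (P k) (P (k + 1)) (P (k + 2)) (P (k + 3)))
          (q (P (k + 1)) (P (k + 2)) (P (k + 3)) (P 0)) +
       up (q (P (k + 1)) (P (k + 2)) (P (k + 3)) (P 0))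
          (q (P (k + 2)) (P (k + 3)) (P 0) (P 1)) +
       up (q (P (k + 2)) (P (k + 3)) (P 0) (P 1))
          (q (P (k + 3)) (P 0) (P 1) (P 2))) := by
  set W := subPolygon V a (k + 3) with hW
  let w : ℕ → Pt := fun i => W (0 + (i : ZMod (k + 3 + 1)))
  have w1 : ∀ i, i ≤ k + 3 → w i = P i := by
    intro i hi
    simp only [w, hW, subPolygon, zero_add, hP]
    rw [ZMod.val_natCast_of_lt (by omega)]
  have w2 : ∀ i, w (k + 4 + i) = w i := by
    intro i
    simp only [w]
    congr 2
    have h := ZMod.natCast_self (k + 3 + 1)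
    push_cast at h ⊢
    linear_combination h
  have p4 : w (k + 4) = P 0 := by rw [w2 0, w1 0 (by omega)]
  have p5 : w (k + 5) = P 1 := by rw [w2 1, w1 1 (by omega)]
  have p6 : w (k + 6) = P 2 := by rw [w2 2, w1 2 (by omega)]
  have p3 : w (k + 3) = P (k + 3) := w1 _ (by omega)
  have p2 : w (k + 2) = P (k + 2) := w1 _ (by omega)
  have p1 : w (k + 1) = P (k + 1) := w1 _ (by omega)
  have p0 : w k = P k := w1 _ (by omega)
  rw [count_poly (k + 3) (by omega) W O R hc 0 w (fun i => rfl)]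
  · rw [Finset.sum_range_succ, Finset.sum_range_succ, Finset.sum_range_succ]
    simp only [add_assoc, Nat.reduceAdd, p0, p1, p2, p3, p4, p5, p6, w1 0 (by omega),
      w1 1 (by omega), w1 2 (by omega), w1 3 (by omega)]
    congr 2
    refine Finset.sum_congr rfl fun i hi => ?_
    have := Finset.mem_range.1 hi
    rw [w1 i (by omega), w1 (i + 1) (by omega), w1 (i + 2) (by omega), w1 (i + 3) (by omega),
      w1 (i + 4) (by omega)]
  · intro i hi
    rcases (by omega : i ≤ k + 1 ∨ i = k + 2 ∨ i = k + 3) with h | h | h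
    · rw [w1 i (by omega), w1 (i + 1) (by omega), w1 (i + 2) (by omega)]
      exact adj i (i + 2) le_rfl (by omega)
    · subst h
      simp only [add_assoc, Nat.reduceAdd, p2, p3, p4]
      have h := adj (k + 2) (0 + n) (by omega) (by omega)
      have e : P (0 + n) = P 0 := by rw [hP, hP]; simp
      rwa [e] at h
    · subst h
      simp only [add_assoc, Nat.reduceAdd, p3, p4, p5]
      rw [← det2_rot]
      exact adj 0 (k + 3) (by omega) (by omega)
  · have inj : ∀ i j : ZMod (k + 3 + 1), i ≠ j →
        a + ((i.val : ℕ) : ZMod n) ≠ a + ((j.val : ℕ) : ZMod n) := by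
      intro i j hij h
      have h := add_left_cancel h
      have hi := ZMod.val_lt i
      have hj := ZMod.val_lt j
      rcases lt_trichotomy i.val j.val with h' | h' | h'
      · exact natCast_ne h' (by omega) h
      · exact hij (ZMod.val_injective _ h')
      · exact natCast_ne h' (by omega) h.symm
    intro i1 i2 i3 i4 h12 h13 h14 h23 h24 h34
    exact hgen.2 _ _ _ _ (inj _ _ h12) (inj _ _ h13) (inj _ _ h14) (inj _ _ h23) (inj _ _ h24)
      (inj _ _ h34)

lemma core (k l : ℕ) [NeZero (k + l + 6)]
    (V O : ZMod (k + l + 6) → Pt) (R : ZMod (k + l + 6) → ℝ)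
    (hconv : ConvexCCW V) (hgen : GenericPoly V) (hcirc : IsCircumData V O R)
    (a : ZMod (k + l + 6))
    (O1 : ZMod (k + 3 + 1) → Pt) (R1 : ZMod (k + 3 + 1) → ℝ)
    (hc1 : IsCircumData (subPolygon V a (k + 3)) O1 R1)
    (O2 : ZMod (l + 3 + 1) → Pt) (R2 : ZMod (l + 3 + 1) → ℝ)
    (hc2 : IsCircumData (subPolygon V (a + ((k + 3 : ℕ) : ZMod (k + l + 6))) (l + 3)) O2 R2) :
    {j : ZMod (k + 3 + 1) | LocMax (subPolygon V a (k + 3)) O1 R1 j}.ncard +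
      {j : ZMod (l + 3 + 1) |
        LocMax (subPolygon V (a + ((k + 3 : ℕ) : ZMod (k + l + 6))) (l + 3)) O2 R2 j}.ncard ≤
    {j : ZMod (k + l + 6) | LocMax V O R j}.ncard + 2 := by
  let P : ℕ → Pt := fun i => V (a + i)
  have adj : ∀ i j, i + 2 ≤ j → j < i + (k + l + 6) → 0 < det2 (P i) (P (i + 1)) (P j) := by
    intro i j h1 h2
    have e : P (i + 1) = V (a + i + 1) := by simp only [P]; push_cast; simp only [add_assoc]
    rw [e]
    refine hconv.2 _ _ ?_ ?_
    · intro h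
      exact natCast_ne (by omega) h2 (add_left_cancel h).symm
    · intro h
      have h : a + (j : ZMod (k + l + 6)) = a + ((i + 1 : ℕ)) := by rw [h]; push_cast; ring
      exact natCast_ne (by omega) (by omega) (add_left_cancel h).symm
  have per : ∀ i, P (k + l + 6 + i) = P i := by
    intro i
    simp only [P]
    rw [Nat.cast_add, ZMod.natCast_self, zero_add]
  have q0 : P (k + l + 6) = P 0 := per 0
  have q1 : P (k + l + 7) = P 1 := per 1
  have q2 : P (k + l + 8) = P 2 := per 2
  have qm : P (k + l + 6 + (k + 3)) = P (k + 3) := per _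
  have c1 := count_sub V hgen a k (by omega) P (fun i => rfl) adj O1 R1 hc1
  have c2 := count_sub V hgen (a + ((k + 3 : ℕ) : ZMod (k + l + 6))) l (by omega)
    (fun i => P (k + 3 + i)) (fun i => by simp only [P]; push_cast; simp only [add_assoc])
    (fun i j h1 h2 => adj (k + 3 + i) (k + 3 + j) (by omega) (by omega)) O2 R2 hc2
  have c : {j : ZMod (k + l + 6) | LocMax V O R j}.ncard = _ := count_poly (k + l + 5) (by omega) V O R hcirc a P (fun i => rfl)
    (fun i hi => adj i (i + 2) le_rfl (by omega)) hgen.2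
  have split : ∀ f : ℕ → ℕ, ∑ i ∈ Finset.range (k + l + 5), f i =
      ∑ i ∈ Finset.range k, f i + f k + f (k + 1) + f (k + 2) +
      (∑ i ∈ Finset.range l, f (k + 3 + i) + f (k + l + 3) + f (k + l + 4)) := by
    intro f
    rw [show k + l + 5 = (k + 3) + (l + 2) by ring, Finset.sum_range_add]
    simp only [Finset.sum_range_succ]
    rw [show k + 3 + l = k + l + 3 by ring, show k + 3 + (l + 1) = k + l + 4 by ring]
  rw [split] at c
  have r0 : k + (3 + l) = k + (l + 3) := by omega
  have r1 : ∀ j, k + (3 + (l + j)) = k + (l + (3 + j)) := fun j => by omega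
  simp only [add_assoc, Nat.reduceAdd, add_zero, r0, r1] at c c1 c2 q0 q1 q2
  rw [q0, q1, q2] at c
  rw [q0] at c2
  -- determinants
  have det0 : ∀ j, 2 ≤ j → j < k + l + 6 → 0 < det2 (P 0) (P 1) (P j) := fun j h1 h2 =>
    adj 0 j (by omega) (by omega)
  have detm : ∀ j, k + 5 ≤ j → j < k + 3 + (k + l + 6) →
      0 < det2 (P (k + 3)) (P (k + 4)) (P j) := fun j h1 h2 => adj (k + 3) j (by omega) (by omega)
  have detm' : ∀ j, k + 4 ≤ j → j < k + 2 + (k + l + 6) →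
      0 < det2 (P (k + 2)) (P (k + 3)) (P j) := fun j h1 h2 => adj (k + 2) j (by omega) (by omega)
  have detn : ∀ j, 1 ≤ j → j < k + l + 5 →
      0 < det2 (P (k + (l + 5))) (P 0) (P j) := by
    intro j h1 h2
    have h := adj (k + (l + 5)) (k + l + 6 + j) (by omega) (by omega)
    rw [per, show k + (l + 5) + 1 = k + (l + 6) by ring, q0] at h
    exact h
  have zero_n : P (k + (l + 6)) = P 0 := q0
  have one_n : P (k + (l + 7)) = P 1 := q1
  -- vertex 0
  have F := boolF (q (P (k + (l + 5))) (P 0) (P 1) (P (k + 3)))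
    (q (P (k + 2)) (P (k + 3)) (P 0) (P 1))
    (q (P (k + (l + 5))) (P 0) (P (k + 3)) (P (k + 4)))
    (q (P 0) (P 1) (P 2) (P 3))
    (q (P (k + (l + 3))) (P (k + (l + 4))) (P (k + (l + 5))) (P 0))
    (q (P (k + (l + 5))) (P 0) (P 1) (P 2))
    (q (P (k + (l + 4))) (P (k + (l + 5))) (P 0) (P 1))
    (q (P (k + 3)) (P 0) (P 1) (P 2))
    (q (P (k + (l + 4))) (P (k + (l + 5))) (P 0) (P (k + 3)))
    (rel1 (det0 _ (by omega) (by omega)) (det0 _ (by omega) (by omega))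
      (det0 _ (by omega) (by omega)))
    (rel2 (detn _ (by omega) (by omega)) (detn _ (by omega) (by omega))
      (detn _ (by omega) (by omega)))
  -- vertex m
  have e0 : 0 < det2 (P (k + 3)) (P (k + 4)) (P 0) := by
    have := detm (k + (l + 6)) (by omega) (by omega)
    rwa [zero_n] at this
  have e0' : 0 < det2 (P (k + 2)) (P (k + 3)) (P 0) := by
    have := detm' (k + (l + 6)) (by omega) (by omega)
    rwa [zero_n] at this
  have e2 : 0 < det2 (P (k + 3)) (P (k + 4)) (P (k + 2)) := by
    rw [det2_rot]
    exact detm' (k + 4) (by omega) (by omega)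
  have e1 : 0 < det2 (P (k + 2)) (P (k + 3)) (P (k + 1)) := by
    rw [det2_rot]
    exact adj (k + 1) (k + 3) (by omega) (by omega)
  have G := boolF (q (P (k + 2)) (P (k + 3)) (P (k + 4)) (P 0))
    (q (P (k + (l + 5))) (P 0) (P (k + 3)) (P (k + 4)))
    (q (P (k + 2)) (P (k + 3)) (P 0) (P 1))
    (q (P (k + 3)) (P (k + 4)) (P (k + 5)) (P (k + 6)))
    (q (P k) (P (k + 1)) (P (k + 2)) (P (k + 3)))
    (q (P (k + 2)) (P (k + 3)) (P (k + 4)) (P (k + 5)))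
    (q (P (k + 1)) (P (k + 2)) (P (k + 3)) (P (k + 4)))
    (q (P 0) (P (k + 3)) (P (k + 4)) (P (k + 5)))
    (q (P (k + 1)) (P (k + 2)) (P (k + 3)) (P 0))
    (rel1 e2 (detm _ (by omega) (by omega)) e0)
    (rel2 e1 (detm' _ (by omega) (by omega)) e0')
  have Cy := cyc (B := P (k + 3)) (C := P 0) (X := P 1) (Y := P (k + 2)) (U := P (k + (l + 5)))
    (W := P (k + 4)) (by rw [← det2_rot]; exact det0 _ (by omega) (by omega))
    (by rw [det2_rot]; exact e0')
    (by rw [det2_rot]; exact detn _ (by omega) (by omega))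
    (by rw [← det2_rot]; exact e0)
  have H := boolFin _ _ _ _ Cy.1 Cy.2
  omega

/-- Decomposing a generic convex polygon with `n ≥ 6` vertices along the diagonal from
`V a` to `V (a+m)` (with `3 ≤ m ≤ n - 3`, so both parts have at least four vertices)
into `P₁, P₂` satisfies `l₋(P) ≥ l₋(P₁) + l₋(P₂) - 2`. -/
theorem decomposition_local_max
    (n : ℕ) [NeZero n] (hn : 6 ≤ n)
    (V O : ZMod n → Pt) (R : ZMod n → ℝ)
    (hconv : ConvexCCW V) (hgen : GenericPoly V) (hcirc : IsCircumData V O R)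
    (a : ZMod n) (m : ℕ) (hm3 : 3 ≤ m) (hmn : m ≤ n - 3)
    (O1 : ZMod (m + 1) → Pt) (R1 : ZMod (m + 1) → ℝ)
    (hc1 : IsCircumData (subPolygon V a m) O1 R1)
    (O2 : ZMod (n - m + 1) → Pt) (R2 : ZMod (n - m + 1) → ℝ)
    (hc2 : IsCircumData (subPolygon V (a + (m : ZMod n)) (n - m)) O2 R2) :
    {k : ZMod (m + 1) | LocMax (subPolygon V a m) O1 R1 k}.ncard +
      {k : ZMod (n - m + 1) |
        LocMax (subPolygon V (a + (m : ZMod n)) (n - m)) O2 R2 k}.ncard ≤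
    {k : ZMod n | LocMax V O R k}.ncard + 2 := by
  obtain ⟨k, rfl⟩ : ∃ k, m = k + 3 := ⟨m - 3, by omega⟩
  obtain ⟨l, rfl⟩ : ∃ l, n = k + l + 6 := ⟨n - k - 6, by omega⟩
  have e : k + l + 6 - (k + 3) = l + 3 := by omega
  generalize k + l + 6 - (k + 3) = M at *
  subst e
  exact core k l V O R hconv hgen hcirc a O1 R1 hc1 O2 R2 hc2
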